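/- Let T be a linear operator bounded from L^{r,1}(ℝⁿ) to L^{r,∞}(ℝⁿ) for some 1 < r < ∞, associated to a kernel K satisfying (i) |K(x,y)| ≤ A|x-y|^{-n} for x ≠ y, with T(f)(x) = ∫ K(x,y)f(y)dy for x ∉ supp f and f compactly supported, and (ii) ∫_{|x-y|≥2|y-y'|} |K(x,y)-K(x,y')| dx ≤ A' for all y,y'. Then T extends to an operator of weak-type (1,1): ‖T(f)‖_{L^{1,∞}(ℝⁿ)} ≤ C(n,r)(A' + ‖T‖_{L^{r,1}→L^{r,∞}}) ‖f‖_{L¹(ℝⁿ)} for all f ∈ L¹(ℝⁿ). -/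

import Mathlib

open MeasureTheory Filter Set Topology ENNReal

noncomputable section
namespace Paper

variable {α ε : Type*} [MeasurableSpace α]

/-- Decreasing rearrangement of `f` with respect to `μ`. -/
def rearr [NNNorm ε] (μ : Measure α) (f : α → ε) (t : ℝ≥0∞) : ℝ≥0∞ :=
  sInf {s : ℝ≥0∞ | μ {x | s < (‖f x‖₊ : ℝ≥0∞)} ≤ t}

/-- Lorentz quasinorm `‖f‖_{L^{p,q}(μ)}` (with the convention `L^{∞,q} = L^∞`). -/
def lorentzNorm [NNNorm ε] (μ : Measure α) (p q : ℝ≥0∞) (f : α → ε) : ℝ≥0∞ :=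
  if p = ∞ then rearr μ f 0
  else if q = ∞ then ⨆ t : ℝ≥0∞, t ^ (1 / p).toReal * rearr μ f t
  else (∫⁻ t in Ioi (0 : ℝ),
      (ENNReal.ofReal t ^ (1 / p).toReal * rearr μ f (ENNReal.ofReal t)) ^ q.toReal
        / ENNReal.ofReal t) ^ (1 / q.toReal)


/-! ### Rearrangements and Lorentz norms -/

lemma rearr_le {μ : Measure α} {f : α → ℂ} {s t : ℝ≥0∞} (h : μ {x | s < ‖f x‖ₑ} ≤ t) :
    rearr μ f t ≤ s := sInf_le h

lemma le_rearr {μ : Measure α} {f : α → ℂ} {s t : ℝ≥0∞} (h : t < μ {x | s < ‖f x‖ₑ}) :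
    s ≤ rearr μ f t := by
  refine le_sInf fun u hu => ?_
  by_contra! hlt
  have h1 : μ {x | s < ‖f x‖ₑ} ≤ μ {x | u < ‖f x‖ₑ} :=
    measure_mono fun x hx => lt_trans hlt hx
  exact absurd (h.trans_le (h1.trans hu)) (lt_irrefl _)

lemma lt_of_lt_rearr {μ : Measure α} {f : α → ℂ} {s t : ℝ≥0∞} (h : s < rearr μ f t) :
    t < μ {x | s < ‖f x‖ₑ} := by
  by_contra! hle
  exact absurd (rearr_le hle) (not_le.2 h)

lemma rearr_antitone (μ : Measure α) (f : α → ℂ) : Antitone (rearr μ f) := by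
  intro t t' htt
  exact sInf_le_sInf fun s hs => le_trans hs htt

lemma weak_of_distr {μ : Measure α} {F : α → ℂ} {D : ℝ≥0∞}
    (h : ∀ l : ℝ, 0 < l → ENNReal.ofReal l * μ {x | ENNReal.ofReal l < ‖F x‖ₑ} ≤ D) :
    lorentzNorm μ 1 ∞ F ≤ D := by
  unfold lorentzNorm
  rw [if_neg ENNReal.one_ne_top, if_pos rfl]
  refine iSup_le fun t => ?_
  have : (1 / (1 : ℝ≥0∞)).toReal = 1 := by simp
  rw [this, ENNReal.rpow_one]
  refine ENNReal.mul_le_of_forall_lt fun a ha b hb => ?_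
  have hb' : b ≠ ∞ := ne_top_of_lt hb
  rcases eq_or_ne b 0 with rfl | hb0
  · simp
  have hpos : 0 < b.toReal := ENNReal.toReal_pos hb0 hb'
  have := h b.toReal hpos
  rw [ENNReal.ofReal_toReal hb'] at this
  refine le_trans ?_ this
  rw [mul_comm]
  gcongr
  exact (ha.trans (lt_of_lt_rearr hb)).le

lemma toReal_one_div_ofReal {r : ℝ} (hr : 1 < r) : (1 / ENNReal.ofReal r).toReal = 1 / r := by
  rw [ENNReal.toReal_div, ENNReal.toReal_ofReal (by linarith), ENNReal.toReal_one]

lemma distr_of_weak {μ : Measure α} {F : α → ℂ} {r : ℝ} (hr : 1 < r) {l : ℝ≥0∞}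
    (hl : l ≠ 0) (hl' : l ≠ ∞) :
    μ {x | l < ‖F x‖ₑ} ≤ (lorentzNorm μ (ENNReal.ofReal r) ∞ F / l) ^ r := by
  refine le_of_forall_lt_imp_le_of_dense fun t ht => ?_
  have h1 : t ^ (1 / r) * l ≤ lorentzNorm μ (ENNReal.ofReal r) ∞ F := by
    unfold lorentzNorm
    rw [if_neg ENNReal.ofReal_ne_top, if_pos rfl, toReal_one_div_ofReal hr]
    refine le_trans ?_ (le_iSup _ t)
    gcongr
    exact le_rearr ht
  have h2 : t ^ (1 / r) ≤ lorentzNorm μ (ENNReal.ofReal r) ∞ F / l := by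
    rw [ENNReal.le_div_iff_mul_le (Or.inl hl) (Or.inl hl')]
    exact h1
  calc t = (t ^ (1 / r)) ^ r := by
        rw [← ENNReal.rpow_mul, one_div, inv_mul_cancel₀ (by linarith), ENNReal.rpow_one]
    _ ≤ _ := ENNReal.rpow_le_rpow h2 (by linarith)

/-- The weight `t^{1/r-1}`, as it appears in the Lorentz norm. -/
lemma lorentz_one_eq {μ : Measure α} {f : α → ℂ} {r : ℝ} (hr : 1 < r) :
    lorentzNorm μ (ENNReal.ofReal r) 1 f =
      ∫⁻ t in Ioi (0 : ℝ), ENNReal.ofReal (t ^ (1 / r - 1)) * rearr μ f (ENNReal.ofReal t) := by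
  unfold lorentzNorm
  rw [if_neg ENNReal.ofReal_ne_top, if_neg ENNReal.one_ne_top, toReal_one_div_ofReal hr]
  simp only [ENNReal.toReal_one, ENNReal.rpow_one, div_one]
  refine setLIntegral_congr_fun measurableSet_Ioi fun t ht => ?_
  have ht : (0 : ℝ) < t := ht
  rw [Real.rpow_sub_one ht.ne', ENNReal.ofReal_div_of_pos ht, ENNReal.ofReal_rpow_of_pos ht]
  simp only [div_eq_mul_inv]
  ring

lemma weight_lintegral_Ioc {r : ℝ} (hr : 1 < r) {s : ℝ} (hs : 0 ≤ s) :
    ∫⁻ t in Ioc (0 : ℝ) s, ENNReal.ofReal (t ^ (1 / r - 1)) =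
      ENNReal.ofReal (r * s ^ (1 / r)) := by
  have hr0 : (0 : ℝ) < 1 / r := by positivity
  have hii : IntervalIntegrable (fun t : ℝ => t ^ (1 / r - 1)) volume 0 s :=
    intervalIntegral.intervalIntegrable_rpow' (by linarith)
  rw [← ofReal_integral_eq_lintegral_ofReal]
  · rw [← intervalIntegral.integral_of_le hs, integral_rpow (Or.inl (by linarith))]
    congr 1
    rw [sub_add_cancel, Real.zero_rpow hr0.ne', sub_zero]
    field_simp
  · exact (intervalIntegrable_iff_integrableOn_Ioc_of_le hs).1 hii
  · filter_upwards [ae_restrict_mem measurableSet_Ioc] with t ht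
    exact Real.rpow_nonneg ht.1.le _

lemma weight_lintegral_Ioi {r : ℝ} (hr : 1 < r) {s : ℝ} (hs : 0 < s) :
    ∫⁻ t in Ioi s, ENNReal.ofReal (t ^ (1 / r - 2)) =
      ENNReal.ofReal (r / (r - 1) * s ^ (1 / r - 1)) := by
  have hr1 : 1 / r < 1 := by rw [div_lt_one (by linarith)]; exact hr
  rw [← ofReal_integral_eq_lintegral_ofReal]
  · rw [integral_Ioi_rpow_of_lt (by linarith) hs]
    congr 1
    have e : 1 / r - 2 + 1 = 1 / r - 1 := by ring
    rw [e]
    have e2 : 1 / r - 1 = - ((r - 1) / r) := by field_simp; ring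
    have : r - 1 ≠ 0 := by linarith
    have hr' : r ≠ 0 := by linarith
    rw [show -s ^ (1 / r - 1) / (1 / r - 1) = s ^ (1 / r - 1) / ((r - 1) / r) by
      rw [neg_div, ← div_neg]; congr 1; rw [e2, neg_neg]]
    field_simp
  · exact integrableOn_Ioi_rpow_of_lt (by linarith) hs
  · filter_upwards [ae_restrict_mem measurableSet_Ioi] with t ht
    exact Real.rpow_nonneg (hs.trans ht).le _

lemma weight_measurable (a : ℝ) : Measurable fun t : ℝ => ENNReal.ofReal (t ^ a) := by
  fun_prop

/-- Majorant for functions `h` with `|h| ≤ |f| + M`, living on a set of measure at most `m`. -/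
def maj (μ : Measure α) (r : ℝ) (f : α → ℂ) (M : ℝ≥0∞) (t : ℝ) : ℝ≥0∞ :=
  ENNReal.ofReal (t ^ (1 / r - 1)) * rearr μ f (ENNReal.ofReal t)
    + ENNReal.ofReal (t ^ (1 / r - 1)) * M

lemma maj_finite {μ : Measure α} {f : α → ℂ} {r : ℝ} (hr : 1 < r) {M : ℝ≥0∞} (hM : M ≠ ∞)
    (hf : lorentzNorm μ (ENNReal.ofReal r) 1 f < ∞) {m : ℝ} (hm : 0 ≤ m) :
    ∫⁻ t in Ioc 0 m, maj μ r f M t ≠ ∞ := by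
  unfold maj
  rw [lintegral_add_right _ ((weight_measurable _).mul_const _),
    lintegral_mul_const _ (weight_measurable _), weight_lintegral_Ioc hr hm]
  rw [lorentz_one_eq hr] at hf
  refine ENNReal.add_ne_top.2 ⟨?_, ENNReal.mul_ne_top ENNReal.ofReal_ne_top hM⟩
  exact ((lintegral_mono_set Ioc_subset_Ioi_self).trans_lt hf).ne

lemma lorentz_le_maj {μ : Measure α} {f h : α → ℂ} {r : ℝ} (hr : 1 < r) {M : ℝ≥0∞}
    (hle : ∀ x, ‖h x‖ₑ ≤ ‖f x‖ₑ + M) {E : Set α} (hE : ∀ x, x ∉ E → h x = 0)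
    {m : ℝ} (hm : μ E ≤ ENNReal.ofReal m) :
    lorentzNorm μ (ENNReal.ofReal r) 1 h ≤ ∫⁻ t in Ioc 0 m, maj μ r f M t := by
  rw [lorentz_one_eq hr]
  have key : ∀ t ∈ Ioi (0 : ℝ), ENNReal.ofReal (t ^ (1 / r - 1)) * rearr μ h (ENNReal.ofReal t)
      ≤ (Ioc 0 m).indicator (maj μ r f M) t := by
    intro t ht
    by_cases htm : t ≤ m
    · rw [indicator_of_mem (show t ∈ Ioc 0 m from ⟨ht, htm⟩), maj, ← mul_add]
      gcongr
      have hb : ∀ s : ℝ≥0∞, rearr μ f (ENNReal.ofReal t) < s →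
          rearr μ h (ENNReal.ofReal t) ≤ s + M := by
        intro s hs
        obtain ⟨u, hu, hus⟩ := sInf_lt_iff.1 hs
        refine rearr_le (le_trans (measure_mono ?_) hu)
        intro x hx
        have hx : s + M < ‖h x‖ₑ := hx
        have : s + M < ‖f x‖ₑ + M := hx.trans_le (hle x)
        have h3 : s < ‖f x‖ₑ := lt_of_add_lt_add_right this
        exact hus.trans h3
      by_cases htop : rearr μ f (ENNReal.ofReal t) = ∞
      · rw [htop]; simp
      by_cases hMt : M = ∞
      · rw [hMt]; simp
      refine ENNReal.le_of_forall_pos_le_add fun e he _ => ?_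
      have := hb (rearr μ f (ENNReal.ofReal t) + e)
        (ENNReal.lt_add_right htop (by exact_mod_cast he.ne'))
      rwa [add_right_comm] at this
    · have : rearr μ h (ENNReal.ofReal t) ≤ 0 := by
        refine rearr_le ?_
        refine le_trans (measure_mono ?_) (hm.trans (ENNReal.ofReal_le_ofReal (not_le.1 htm).le))
        intro x hx
        by_contra hxE
        have hx : 0 < ‖h x‖ₑ := hx
        rw [hE x hxE] at hx
        simp at hx
      rw [le_zero_iff.1 this]
      simp
  calc _ ≤ ∫⁻ t in Ioi (0 : ℝ), (Ioc 0 m).indicator (maj μ r f M) t :=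
        setLIntegral_mono' measurableSet_Ioi key
    _ ≤ ∫⁻ t, (Ioc 0 m).indicator (maj μ r f M) t := setLIntegral_le_lintegral _ _
    _ = _ := lintegral_indicator measurableSet_Ioc _

lemma lorentz_good {μ : Measure α} {g : α → ℂ} (hgm : AEMeasurable g μ) {r : ℝ} (hr : 1 < r)
    {M G : ℝ} (hM : 0 < M) (hG : 0 < G)
    (hg : ∀ᵐ x ∂μ, ‖g x‖ₑ ≤ ENNReal.ofReal M) (hgG : ∫⁻ x, ‖g x‖ₑ ∂μ ≤ ENNReal.ofReal G) :
    lorentzNorm μ (ENNReal.ofReal r) 1 g ≤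
      ENNReal.ofReal ((r + r / (r - 1)) * (M * (G / M) ^ (1 / r))) := by
  rw [lorentz_one_eq hr]
  have hs : 0 < G / M := by positivity
  set s := G / M with hsdef
  have hr1 : 0 < r - 1 := by linarith
  rw [← Ioc_union_Ioi_eq_Ioi hs.le, lintegral_union measurableSet_Ioi (Ioc_disjoint_Ioi le_rfl)]
  have h1 : ∫⁻ t in Ioc 0 s, ENNReal.ofReal (t ^ (1 / r - 1)) * rearr μ g (ENNReal.ofReal t)
      ≤ ENNReal.ofReal (r * s ^ (1 / r)) * ENNReal.ofReal M := by
    rw [← weight_lintegral_Ioc hr hs.le, ← lintegral_mul_const _ (weight_measurable _)]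
    refine lintegral_mono fun t => ?_
    gcongr
    refine rearr_le (le_trans (le_of_eq ?_) (zero_le (a := ENNReal.ofReal t)))
    refine measure_mono_null (fun x hx => ?_) (ae_iff.1 hg)
    exact not_le.2 hx
  have h2 : ∫⁻ t in Ioi s, ENNReal.ofReal (t ^ (1 / r - 1)) * rearr μ g (ENNReal.ofReal t)
      ≤ ENNReal.ofReal (r / (r - 1) * s ^ (1 / r - 1)) * ENNReal.ofReal G := by
    rw [← weight_lintegral_Ioi hr hs, ← lintegral_mul_const _ (weight_measurable _)]
    refine setLIntegral_mono' measurableSet_Ioi fun t ht => ?_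
    have ht0 : 0 < t := hs.trans ht
    have hre : rearr μ g (ENNReal.ofReal t) ≤ ENNReal.ofReal (G / t) := by
      refine rearr_le ?_
      have hGt : 0 < G / t := by positivity
      calc μ {x | ENNReal.ofReal (G / t) < ‖g x‖ₑ}
          ≤ μ {x | ENNReal.ofReal (G / t) ≤ ‖g x‖ₑ} := measure_mono fun x hx => by
            exact (show ENNReal.ofReal (G / t) < ‖g x‖ₑ from hx).le
        _ ≤ (∫⁻ x, ‖g x‖ₑ ∂μ) / ENNReal.ofReal (G / t) :=
            meas_ge_le_lintegral_div hgm.enorm (ENNReal.ofReal_pos.2 hGt).ne'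
              ENNReal.ofReal_ne_top
        _ ≤ ENNReal.ofReal G / ENNReal.ofReal (G / t) := by gcongr
        _ = ENNReal.ofReal t := by
            rw [← ENNReal.ofReal_div_of_pos hGt]; congr 1; field_simp
    calc _ ≤ ENNReal.ofReal (t ^ (1 / r - 1)) * ENNReal.ofReal (G / t) := by gcongr
      _ = _ := by
        rw [← ENNReal.ofReal_mul (by positivity), ← ENNReal.ofReal_mul (by positivity)]
        congr 1
        rw [show 1 / r - 2 = (1 / r - 1) - 1 by ring, Real.rpow_sub_one ht0.ne' (1 / r - 1)]
        ring
  refine (add_le_add h1 h2).trans (le_of_eq ?_)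
  rw [← ENNReal.ofReal_mul (by positivity), ← ENNReal.ofReal_mul (by positivity),
    ← ENNReal.ofReal_add (by positivity) (by positivity)]
  congr 1
  rw [Real.rpow_sub_one hs.ne']
  have : G = s * M := by rw [hsdef]; field_simp
  rw [this]
  field_simp

/-! ### Dyadic cubes -/

/-- The dyadic cube of generation `k` (side `2^{-k}`) with corner `2^{-k} m`. -/
def cube {n : ℕ} (k : ℤ) (m : Fin n → ℤ) : Set (EuclideanSpace ℝ (Fin n)) :=
  {y | ∀ i, ⌊(2 : ℝ) ^ k * y i⌋ = m i}

/-- The lower corner of a dyadic cube. -/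
def corner {n : ℕ} (k : ℤ) (m : Fin n → ℤ) : EuclideanSpace ℝ (Fin n) :=
  WithLp.toLp 2 fun i => m i * (2 : ℝ) ^ (-k)

lemma mem_cube_iff {n : ℕ} {k : ℤ} {m : Fin n → ℤ} {y : EuclideanSpace ℝ (Fin n)} :
    y ∈ cube k m ↔ ∀ i, m i * (2 : ℝ) ^ (-k) ≤ y i ∧ y i < m i * (2 : ℝ) ^ (-k) + (2 : ℝ) ^ (-k) := by
  have h2 : (0 : ℝ) < 2 ^ k := by positivity
  refine forall_congr' fun i => ?_
  rw [Int.floor_eq_iff, zpow_neg, ← div_eq_mul_inv, div_le_iff₀ h2]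
  constructor
  · rintro ⟨h, h'⟩
    refine ⟨by linarith, ?_⟩
    rw [← one_div, ← add_div, lt_div_iff₀ h2]
    linarith
  · rintro ⟨h, h'⟩
    refine ⟨by linarith, ?_⟩
    rw [← one_div, ← add_div, lt_div_iff₀ h2] at h'
    linarith

lemma cube_eq_preimage {n : ℕ} (k : ℤ) (m : Fin n → ℤ) :
    cube k m = (MeasurableEquiv.toLp 2 (Fin n → ℝ)).symm ⁻¹'
      (univ.pi fun i => Ico (m i * (2 : ℝ) ^ (-k)) (m i * (2 : ℝ) ^ (-k) + (2 : ℝ) ^ (-k))) := by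
  ext y
  rw [mem_cube_iff]
  simp [MeasurableEquiv.coe_toLp_symm]

lemma measurableSet_cube {n : ℕ} (k : ℤ) (m : Fin n → ℤ) : MeasurableSet (cube k m) := by
  rw [cube_eq_preimage]
  exact (MeasurableEquiv.measurable _) (MeasurableSet.univ_pi fun i => measurableSet_Ico)

lemma volume_cube {n : ℕ} (k : ℤ) (m : Fin n → ℤ) :
    volume (cube k m) = ENNReal.ofReal (((2 : ℝ) ^ (-k)) ^ n) := by
  rw [cube_eq_preimage,
    (EuclideanSpace.volume_preserving_symm_measurableEquiv_toLp (Fin n)).measure_preimage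
      (MeasurableSet.univ_pi fun i => measurableSet_Ico).nullMeasurableSet, Real.volume_pi_Ico]
  simp only [add_sub_cancel_left, Finset.prod_const, Finset.card_univ, Fintype.card_fin]
  rw [ENNReal.ofReal_pow (by positivity)]

lemma volume_cube_pos {n : ℕ} (k : ℤ) (m : Fin n → ℤ) : volume (cube k m) ≠ 0 := by
  rw [volume_cube]
  exact (ENNReal.ofReal_pos.2 (by positivity)).ne'

lemma volume_cube_ne_top {n : ℕ} (k : ℤ) (m : Fin n → ℤ) : volume (cube k m) ≠ ∞ := by
  rw [volume_cube]
  exact ENNReal.ofReal_ne_top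

lemma cube_nested {n : ℕ} {k k' : ℤ} (hk : k' ≤ k) {m m' : Fin n → ℤ}
    {x : EuclideanSpace ℝ (Fin n)} (hx : x ∈ cube k m) (hx' : x ∈ cube k' m') :
    cube k m ⊆ cube k' m' := by
  obtain ⟨d, rfl⟩ := Int.exists_add_of_le hk
  intro y hy i
  have h1 := hx i
  have h2 := hx' i
  have h3 := hy i
  have e : ∀ z : ℝ, (2 : ℝ) ^ (k' + d) * z = 2 ^ d * (2 ^ k' * z) := by
    intro z
    rw [zpow_add₀ (by norm_num)]
    simp
    ring
  rw [e] at h1 h3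
  rw [← h2]
  have hd : (0 : ℝ) < 2 ^ d := by positivity
  have aux : ∀ u v : ℝ, ⌊2 ^ d * u⌋ = ⌊2 ^ d * v⌋ → ⌊u⌋ ≤ ⌊v⌋ := by
    intro u v huv
    rw [Int.le_floor]
    have h4 : ((2 ^ d * ⌊u⌋ : ℤ) : ℝ) ≤ 2 ^ d * u := by
      push_cast
      gcongr
      exact Int.floor_le u
    have h5 := Int.le_floor.2 h4
    rw [huv] at h5
    have h6 := Int.le_floor.1 h5
    push_cast at h6
    exact le_of_mul_le_mul_left h6 hd
  exact le_antisymm (aux _ _ (h3.trans h1.symm)) (aux _ _ (h1.trans h3.symm))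

lemma mem_own_cube {n : ℕ} (k : ℤ) (x : EuclideanSpace ℝ (Fin n)) :
    x ∈ cube k (fun i => ⌊(2 : ℝ) ^ k * x i⌋) := fun _ => rfl

lemma cube_index_eq {n : ℕ} {k : ℤ} {m : Fin n → ℤ} {x : EuclideanSpace ℝ (Fin n)}
    (hx : x ∈ cube k m) : m = fun i => ⌊(2 : ℝ) ^ k * x i⌋ := funext fun i => (hx i).symm

lemma cube_nonempty {n : ℕ} (k : ℤ) (m : Fin n → ℤ) : (cube k m).Nonempty :=
  nonempty_of_measure_ne_zero (volume_cube_pos k m)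

lemma dist_corner {n : ℕ} {k : ℤ} {m : Fin n → ℤ} {y : EuclideanSpace ℝ (Fin n)}
    (hy : y ∈ cube k m) : ‖y - corner k m‖ ≤ Real.sqrt n * (2 : ℝ) ^ (-k) := by
  rw [mem_cube_iff] at hy
  rw [EuclideanSpace.norm_eq]
  have hp : (0 : ℝ) ≤ 2 ^ (-k) := by positivity
  calc Real.sqrt (∑ i, ‖(y - corner k m) i‖ ^ 2)
      ≤ Real.sqrt (∑ _i : Fin n, ((2 : ℝ) ^ (-k)) ^ 2) := by
        refine Real.sqrt_le_sqrt (Finset.sum_le_sum fun i _ => ?_)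
        gcongr
        have e : (y - corner k m) i = y i - m i * (2 : ℝ) ^ (-k) := rfl
        rw [e, Real.norm_eq_abs, abs_le]
        constructor <;> linarith [(hy i).1, (hy i).2]
    _ = _ := by
        rw [Finset.sum_const, Finset.card_univ, Fintype.card_fin, nsmul_eq_mul,
          Real.sqrt_mul (by positivity), Real.sqrt_sq hp]

/-- The geometric constant: volume ratio between dilated ball and cube. -/
def geomC (n : ℕ) : ℝ≥0∞ :=
  ENNReal.ofReal ((2 * Real.sqrt n) ^ n) *
    volume (Metric.ball (0 : EuclideanSpace ℝ (Fin n)) 1)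

lemma geomC_ne_top (n : ℕ) : geomC n ≠ ∞ :=
  ENNReal.mul_ne_top ENNReal.ofReal_ne_top measure_ball_lt_top.ne

lemma volume_dilate {n : ℕ} (k : ℤ) (m : Fin n → ℤ) :
    volume (Metric.closedBall (corner k m) (2 * (Real.sqrt n * (2 : ℝ) ^ (-k))))
      = geomC n * volume (cube k m) := by
  rw [Measure.addHaar_closedBall _ _ (by positivity), volume_cube, geomC,
    finrank_euclideanSpace_fin, mul_right_comm, ← ENNReal.ofReal_mul (by positivity), ← mul_pow]
  ring_nf

/-- Lebesgue differentiation along dyadic cubes, in the form needed for the decomposition. -/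
lemma ae_le_of_cubes {n : ℕ} {f : EuclideanSpace ℝ (Fin n) → ℂ} (hf : Integrable f volume)
    {a : ℝ} (ha : 0 ≤ a) :
    ∀ᵐ x ∂(volume : Measure (EuclideanSpace ℝ (Fin n))),
      (∀ k : ℤ, ∀ m, x ∈ cube k m →
        ∫⁻ y in cube k m, ‖f y‖ₑ ≤ ENNReal.ofReal a * volume (cube k m)) →
      ‖f x‖ₑ ≤ ENNReal.ofReal a := by
  set e := (MeasurableEquiv.toLp 2 (Fin n → ℝ)).symm with he
  have hmp : MeasurePreserving e volume volume :=
    EuclideanSpace.volume_preserving_symm_measurableEquiv_toLp (Fin n)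
  set F : (Fin n → ℝ) → ℝ := fun z => ‖f (e.symm z)‖ with hF
  have hFint : Integrable F volume :=
    ((hmp.symm e).integrable_comp_emb e.symm.measurableEmbedding).2 hf.norm
  have hleb := IsUnifLocDoublingMeasure.ae_tendsto_average (volume : Measure (Fin n → ℝ))
    hFint.locallyIntegrable 1
  have hleb' := hmp.quasiMeasurePreserving.ae hleb
  filter_upwards [hleb'] with x hx hcube
  have hFx : F (e x) = ‖f x‖ := by simp [hF]
  -- centers and radii
  let w : ℕ → (Fin n → ℝ) := fun k i =>
    ⌊(2 : ℝ) ^ (k : ℤ) * x i⌋ * (2 : ℝ) ^ (-(k : ℤ)) + (2 : ℝ) ^ (-(k : ℤ)) / 2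
  let δ : ℕ → ℝ := fun k => (2 : ℝ) ^ (-(k : ℤ)) / 2
  have hδpos : ∀ k, 0 < δ k := fun k => by positivity
  have hδ : Tendsto δ atTop (𝓝[>] 0) := by
    refine tendsto_nhdsWithin_iff.2 ⟨?_, Eventually.of_forall hδpos⟩
    have h0 : Tendsto (fun k : ℕ => ((1 / 2 : ℝ)) ^ k / 2) atTop (𝓝 (0 / 2)) :=
      (_root_.tendsto_pow_atTop_nhds_zero_of_lt_one (by norm_num) (by norm_num)).div_const 2
    rw [zero_div] at h0
    refine h0.congr fun k => ?_
    simp [δ]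
  -- the closed sup-norm ball is the closed cube
  have hball : ∀ k : ℕ, e ⁻¹' (Metric.closedBall (w k) (δ k)) =ᵐ[volume]
      cube (k : ℤ) (fun i => ⌊(2 : ℝ) ^ (k : ℤ) * x i⌋) := by
    intro k
    have hsub : cube (k : ℤ) (fun i => ⌊(2 : ℝ) ^ (k : ℤ) * x i⌋) ⊆
        e ⁻¹' (Metric.closedBall (w k) (δ k)) := by
      intro y hy
      rw [mem_cube_iff] at hy
      rw [mem_preimage, Metric.mem_closedBall, dist_pi_le_iff (hδpos k).le]
      intro i
      have := hy i
      rw [Real.dist_eq, abs_le]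
      have ey : e y i = y i := rfl
      simp only [ey, w, δ]
      constructor <;> linarith [this.1, this.2]
    have hvol : volume (e ⁻¹' (Metric.closedBall (w k) (δ k))) =
        volume (cube (k : ℤ) (fun i => ⌊(2 : ℝ) ^ (k : ℤ) * x i⌋)) := by
      rw [hmp.measure_preimage Metric.isClosed_closedBall.measurableSet.nullMeasurableSet,
        Real.volume_pi_closedBall _ (hδpos k).le, volume_cube]
      simp only [δ, Fintype.card_fin]
      congr 2
      ring
    refine (ae_eq_of_subset_of_measure_ge hsub hvol.le
      (measurableSet_cube _ _).nullMeasurableSet ?_).symm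
    rw [hvol]
    exact volume_cube_ne_top _ _
  have hlim := hx w δ hδ (Eventually.of_forall fun k => by
    have : x ∈ e ⁻¹' (Metric.closedBall (w k) (δ k)) := by
      rw [mem_preimage, Metric.mem_closedBall, dist_pi_le_iff (hδpos k).le]
      intro i
      have := mem_cube_iff.1 (mem_own_cube (k : ℤ) x) i
      rw [Real.dist_eq, abs_le]
      have ey : e x i = x i := rfl
      simp only [ey, w, δ]
      constructor <;> linarith [this.1, this.2]
    rw [one_mul]
    exact this)
  rw [hFx] at hlim
  have hle : ‖f x‖ ≤ a := by
    refine le_of_tendsto hlim (Eventually.of_forall fun k => ?_)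
    set Q := cube (k : ℤ) (fun i => ⌊(2 : ℝ) ^ (k : ℤ) * x i⌋) with hQ
    have h1 : ∫ z in Metric.closedBall (w k) (δ k), F z = ∫ y in Q, ‖f y‖ := by
      rw [← setIntegral_congr_set (hball k),
        ← hmp.setIntegral_preimage_emb e.measurableEmbedding]
      simp [hF]
    have h2 : volume (Metric.closedBall (w k) (δ k)) = volume Q := by
      rw [← measure_congr (hball k),
        hmp.measure_preimage Metric.isClosed_closedBall.measurableSet.nullMeasurableSet]
    rw [setAverage_eq, h1, measureReal_def, h2, smul_eq_mul]
    have hv : 0 < (volume Q).toReal :=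
      ENNReal.toReal_pos (volume_cube_pos _ _) (volume_cube_ne_top _ _)
    rw [inv_mul_le_iff₀ hv]
    have h3 := hcube (k : ℤ) _ (mem_own_cube (k : ℤ) x)
    rw [integral_norm_eq_lintegral_enorm hf.aestronglyMeasurable.restrict]
    have h4 := ENNReal.toReal_mono
      (ENNReal.mul_ne_top ENNReal.ofReal_ne_top (volume_cube_ne_top _ _)) h3
    rw [ENNReal.toReal_mul, ENNReal.toReal_ofReal ha] at h4
    rw [mul_comm]
    exact h4
  rw [← ofReal_norm]
  exact ENNReal.ofReal_le_ofReal hle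

/-! ### The Calderón–Zygmund decomposition -/

lemma cz_cubes {n : ℕ} (hn : 0 < n) {f : EuclideanSpace ℝ (Fin n) → ℂ}
    (hf : Integrable f volume) {a : ℝ} (ha : 0 < a) :
    ∃ S : Set (ℤ × (Fin n → ℤ)),
      (∀ i ∈ S, ∀ j ∈ S, i ≠ j → Disjoint (cube i.1 i.2) (cube j.1 j.2)) ∧
      (∀ j ∈ S, ENNReal.ofReal a * volume (cube j.1 j.2) ≤ ∫⁻ y in cube j.1 j.2, ‖f y‖ₑ) ∧
      (∀ j ∈ S, ∫⁻ y in cube j.1 j.2, ‖f y‖ₑ ≤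
        ENNReal.ofReal (2 ^ n * a) * volume (cube j.1 j.2)) ∧
      ∀ᵐ x ∂(volume : Measure (EuclideanSpace ℝ (Fin n))),
        (∀ j ∈ S, x ∉ cube j.1 j.2) → ‖f x‖ₑ ≤ ENNReal.ofReal a := by
  let P : ℤ → (Fin n → ℤ) → Prop := fun k m =>
    ENNReal.ofReal a * volume (cube k m) < ∫⁻ y in cube k m, ‖f y‖ₑ
  let S : Set (ℤ × (Fin n → ℤ)) := {j | P j.1 j.2 ∧
    ∀ k' < j.1, ∀ m', cube j.1 j.2 ⊆ cube k' m' → ¬ P k' m'}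
  have hcover : ∀ x k m, x ∈ cube k m → P k m → ∃ j ∈ S, x ∈ cube j.1 j.2 := by
    intro x k m hx hP
    have hbdd : ∃ b : ℤ, ∀ z : ℤ, P z (fun i => ⌊(2 : ℝ) ^ z * x i⌋) → b ≤ z := by
      set I : ℝ := (∫⁻ y, ‖f y‖ₑ).toReal with hI
      have hfin : ∫⁻ y, ‖f y‖ₑ ≠ ∞ := hf.2.ne
      obtain ⟨N, hN⟩ := pow_unbounded_of_one_lt (I / a) (one_lt_two (α := ℝ))
      refine ⟨-N, fun z hz => ?_⟩
      by_contra! hlt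
      have h1 : ENNReal.ofReal (a * ((2 : ℝ) ^ (-z)) ^ n) < ENNReal.ofReal I := by
        rw [ENNReal.ofReal_mul ha.le, ← volume_cube z (fun i => ⌊(2 : ℝ) ^ z * x i⌋), hI,
          ENNReal.ofReal_toReal hfin]
        exact lt_of_lt_of_le hz (setLIntegral_le_lintegral _ _)
      have h2 := (ENNReal.ofReal_lt_ofReal_iff_of_nonneg (by positivity)).1 h1
      have h3 : (2 : ℝ) ^ N ≤ 2 ^ (-z) := by
        rw [← zpow_natCast]
        exact zpow_le_zpow_right₀ (by norm_num) (by omega)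
      have h4 : (1 : ℝ) ≤ 2 ^ (-z) := le_trans (one_le_pow₀ (by norm_num)) h3
      have h5 : (2 : ℝ) ^ (-z) ≤ (2 ^ (-z)) ^ n := le_self_pow₀ h4 hn.ne'
      rw [div_lt_iff₀ ha] at hN
      have : a * 2 ^ N ≤ a * ((2 : ℝ) ^ (-z)) ^ n := by
        gcongr
        exact h3.trans h5
      linarith
    have hne : ∃ z : ℤ, P z (fun i => ⌊(2 : ℝ) ^ z * x i⌋) := by
      refine ⟨k, ?_⟩
      rw [← cube_index_eq hx]
      exact hP
    obtain ⟨z, hz, hmin⟩ := Int.exists_least_of_bdd hbdd hne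
    refine ⟨(z, fun i => ⌊(2 : ℝ) ^ z * x i⌋), ⟨hz, ?_⟩, mem_own_cube z x⟩
    intro k' hk' m' hsub hP'
    have hxm := hsub (mem_own_cube z x)
    rw [cube_index_eq hxm] at hP'
    exact absurd (hmin k' hP') (not_le.2 hk')
  refine ⟨S, ?_, fun j hj => hj.1.le, ?_, ?_⟩
  · intro i hi j hj hij
    rw [Set.disjoint_left]
    intro x hxi hxj
    rcases lt_trichotomy i.1 j.1 with h | h | h
    · exact hj.2 _ h _ (cube_nested h.le hxj hxi) hi.1
    · refine hij (Prod.ext h ?_)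
      rw [cube_index_eq hxi, cube_index_eq hxj, h]
    · exact hi.2 _ h _ (cube_nested h.le hxi hxj) hj.1
  · intro j hj
    obtain ⟨x, hx⟩ := cube_nonempty j.1 j.2
    have hsub := cube_nested (by omega : j.1 - 1 ≤ j.1) hx (mem_own_cube (j.1 - 1) x)
    have hnp := not_lt.1 (hj.2 _ (by omega) _ hsub)
    refine (lintegral_mono_set hsub).trans (hnp.trans (le_of_eq ?_))
    rw [volume_cube, volume_cube, ← ENNReal.ofReal_mul ha.le, ← ENNReal.ofReal_mul (by positivity)]
    congr 1
    rw [show -(j.1 - 1) = -j.1 + 1 by ring, zpow_add_one₀ (by norm_num), mul_pow]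
    ring
  · filter_upwards [ae_le_of_cubes hf ha.le] with x hx hxS
    refine hx fun k m hxk => ?_
    by_contra! hlt
    obtain ⟨j, hj, hxj⟩ := hcover x k m hxk hlt
    exact hxS j hj hxj

/-- The Calderón–Zygmund decomposition at height `a`. -/
lemma cz_decomp {n : ℕ} (hn : 0 < n) {f : EuclideanSpace ℝ (Fin n) → ℂ} (hfm : Measurable f)
    (hf : Integrable f volume) {a : ℝ} (ha : 0 < a) :
    ∃ (ι : Type) (_ : Countable ι) (Q : ι → Set (EuclideanSpace ℝ (Fin n)))
      (c : ι → EuclideanSpace ℝ (Fin n)) (ρ : ι → ℝ) (g : EuclideanSpace ℝ (Fin n) → ℂ),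
      (∀ j, MeasurableSet (Q j)) ∧
      (Pairwise fun i j => Disjoint (Q i) (Q j)) ∧
      (∀ j, 0 < ρ j) ∧
      (∀ j, Q j ⊆ Metric.closedBall (c j) (ρ j)) ∧
      (∀ j, volume (Metric.closedBall (c j) (2 * ρ j)) = geomC n * volume (Q j)) ∧
      (∑' j, volume (Q j) ≤ (∫⁻ x, ‖f x‖ₑ) / ENNReal.ofReal a) ∧
      Measurable g ∧
      (∀ᵐ x ∂volume, ‖g x‖ₑ ≤ ENNReal.ofReal (2 ^ n * a)) ∧
      (∀ x, ‖f x - g x‖ₑ ≤ ‖f x‖ₑ + ENNReal.ofReal (2 ^ n * a)) ∧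
      (∀ x, x ∉ ⋃ j, Q j → f x - g x = 0) ∧
      (∫⁻ x, ‖g x‖ₑ ≤ ∫⁻ x, ‖f x‖ₑ) ∧
      (∀ j, ∫ x in Q j, (f x - g x) = 0) ∧
      (∑' j, ∫⁻ x in Q j, ‖f x - g x‖ₑ ≤ 2 * ∫⁻ x, ‖f x‖ₑ) := by
  obtain ⟨S, hdisj, hlow, hup, hae⟩ := cz_cubes hn hf ha
  let Q : S → Set (EuclideanSpace ℝ (Fin n)) := fun j => cube j.1.1 j.1.2
  have hQm : ∀ j, MeasurableSet (Q j) := fun j => measurableSet_cube _ _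
  have hQ0 : ∀ j, volume (Q j) ≠ 0 := fun j => volume_cube_pos _ _
  have hQt : ∀ j, volume (Q j) ≠ ∞ := fun j => volume_cube_ne_top _ _
  have hQd : Pairwise fun i j => Disjoint (Q i) (Q j) := fun i j hij =>
    hdisj i.1 i.2 j.1 j.2 fun h => hij (Subtype.ext h)
  let avg : S → ℂ := fun j => ⨍ x in Q j, f x
  -- bound for averages
  have havg : ∀ j, ‖avg j‖ₑ * volume (Q j) ≤ ∫⁻ x in Q j, ‖f x‖ₑ := by
    intro j
    have h1 : avg j = (volume.real (Q j))⁻¹ • ∫ x in Q j, f x := setAverage_eq _ _ _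
    have h2 : (volume.real (Q j)) ≠ 0 := (ENNReal.toReal_pos (hQ0 j) (hQt j)).ne'
    have h3 : ‖((volume.real (Q j))⁻¹ : ℝ)‖ₑ = (volume (Q j))⁻¹ := by
      rw [enorm_inv h2, measureReal_def, Real.enorm_of_nonneg ENNReal.toReal_nonneg,
        ENNReal.ofReal_toReal (hQt j)]
    rw [h1, enorm_smul, h3, mul_right_comm, ENNReal.inv_mul_cancel (hQ0 j) (hQt j), one_mul]
    exact enorm_integral_le_lintegral_enorm _
  have havg' : ∀ j, ‖avg j‖ₑ ≤ ENNReal.ofReal (2 ^ n * a) := by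
    intro j
    have := (havg j).trans (hup j.1 j.2)
    exact (ENNReal.mul_le_mul_iff_left (hQ0 j) (hQt j)).1 this
  obtain ⟨g, hgm, hg⟩ := exists_measurable_piecewise
    (fun o : Option S => o.elim ((⋃ j, Q j)ᶜ) Q)
    (by
      rintro (_ | j)
      · exact (MeasurableSet.iUnion hQm).compl
      · exact hQm j)
    (fun o : Option S => o.elim f (fun j _ => avg j))
    (by
      rintro (_ | j)
      · exact hfm
      · exact measurable_const)
    (by
      rintro (_ | i) (_ | j) hij x ⟨hx1, hx2⟩
      · exact absurd rfl hij
      · exact absurd (mem_iUnion.2 ⟨j, hx2⟩) hx1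
      · exact absurd (mem_iUnion.2 ⟨i, hx1⟩) hx2
      · have : i ≠ j := fun h => hij (by rw [h])
        exact absurd hx2 (Set.disjoint_left.1 (hQd this) hx1))
  have hg0 : ∀ x, x ∉ ⋃ j, Q j → g x = f x := fun x hx => hg none hx
  have hgj : ∀ j, ∀ x ∈ Q j, g x = avg j := fun j x hx => hg (some j) hx
  have hgQ : ∀ j, ∫⁻ x in Q j, ‖g x‖ₑ ≤ ∫⁻ x in Q j, ‖f x‖ₑ := by
    intro j
    rw [setLIntegral_congr_fun (hQm j) (fun x hx => by rw [hgj j x hx]), setLIntegral_const]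
    exact havg j
  have hUm : MeasurableSet (⋃ j, Q j) := MeasurableSet.iUnion hQm
  have hsumf : ∑' j, ∫⁻ x in Q j, ‖f x‖ₑ ≤ ∫⁻ x, ‖f x‖ₑ := by
    rw [← lintegral_iUnion hQm hQd]
    exact setLIntegral_le_lintegral _ _
  refine ⟨S, inferInstance, Q, fun j => corner j.1.1 j.1.2,
    fun j => Real.sqrt n * (2 : ℝ) ^ (-j.1.1), g, hQm, hQd, ?_, ?_, ?_, ?_, hgm, ?_, ?_, ?_, ?_,
    ?_, ?_⟩
  · intro j
    have : (0 : ℝ) < n := by exact_mod_cast hn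
    positivity
  · intro j x hx
    rw [Metric.mem_closedBall, dist_eq_norm]
    exact dist_corner hx
  · intro j
    exact volume_dilate _ _
  · rw [ENNReal.le_div_iff_mul_le (Or.inl (ENNReal.ofReal_pos.2 ha).ne')
      (Or.inl ENNReal.ofReal_ne_top), ← ENNReal.tsum_mul_right]
    refine le_trans (ENNReal.tsum_le_tsum fun j => ?_) hsumf
    rw [mul_comm]
    exact hlow j.1 j.2
  · filter_upwards [hae] with x hx
    by_cases hxU : x ∈ ⋃ j, Q j
    · obtain ⟨j, hj⟩ := mem_iUnion.1 hxU
      rw [hgj j x hj]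
      exact havg' j
    · rw [hg0 x hxU]
      refine (hx fun j hj hxj => hxU (mem_iUnion.2 ⟨⟨j, hj⟩, hxj⟩)).trans ?_
      refine ENNReal.ofReal_le_ofReal ?_
      have : (1 : ℝ) ≤ 2 ^ n := one_le_pow₀ (by norm_num)
      nlinarith
  · intro x
    by_cases hxU : x ∈ ⋃ j, Q j
    · obtain ⟨j, hj⟩ := mem_iUnion.1 hxU
      rw [hgj j x hj]
      exact (enorm_sub_le).trans (by gcongr; exact havg' j)
    · rw [hg0 x hxU]
      simp
  · intro x hx
    rw [hg0 x hx, sub_self]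
  · rw [← lintegral_add_compl _ hUm, ← lintegral_add_compl (fun x => ‖f x‖ₑ) hUm]
    refine add_le_add ?_ (le_of_eq ?_)
    · rw [lintegral_iUnion hQm hQd, lintegral_iUnion hQm hQd]
      exact ENNReal.tsum_le_tsum hgQ
    · exact setLIntegral_congr_fun hUm.compl fun x hx => by rw [hg0 x hx]
  · intro j
    rw [setIntegral_congr_fun (g := fun x => f x - avg j) (hQm j) (fun x hx => by
      simp only [hgj j x hx])]
    have : IsFiniteMeasure (volume.restrict (Q j)) :=
      ⟨by rw [Measure.restrict_apply_univ]; exact (hQt j).lt_top⟩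
    exact integral_sub_average (volume.restrict (Q j)) f
  · rw [two_mul]
    refine le_trans (ENNReal.tsum_le_tsum fun j => ?_)
      (le_trans (le_of_eq (ENNReal.tsum_add (f := fun j => ∫⁻ x in Q j, ‖f x‖ₑ)
        (g := fun j => ∫⁻ x in Q j, ‖f x‖ₑ))) (add_le_add hsumf hsumf))
    calc ∫⁻ x in Q j, ‖f x - g x‖ₑ ≤ ∫⁻ x in Q j, (‖f x‖ₑ + ‖g x‖ₑ) :=
          lintegral_mono fun x => enorm_sub_le
      _ = (∫⁻ x in Q j, ‖f x‖ₑ) + ∫⁻ x in Q j, ‖g x‖ₑ := lintegral_add_left hfm.enorm _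
      _ ≤ _ := add_le_add le_rfl (hgQ j)

/-! ### The bad part -/

lemma bad_piece {n : ℕ} {K : EuclideanSpace ℝ (Fin n) → EuclideanSpace ℝ (Fin n) → ℂ}
    (hK : Measurable (Function.uncurry K)) {A A' : ℝ} (hA : 0 ≤ A)
    (hsize : ∀ x y, x ≠ y → ‖K x y‖ ≤ A * ‖x - y‖ ^ (-(n : ℝ)))
    (hhor : ∀ y y', ∫⁻ x in {x | 2 * ‖y - y'‖ ≤ ‖x - y‖},
          (‖K x y - K x y'‖₊ : ℝ≥0∞) ∂volume ≤ ENNReal.ofReal A')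
    {b Tb : EuclideanSpace ℝ (Fin n) → ℂ} (hbm : Measurable b) (hb : Integrable b volume)
    {c : EuclideanSpace ℝ (Fin n)} {ρ : ℝ} (hρ : 0 < ρ)
    (hsupp : ∀ x, x ∉ Metric.closedBall c ρ → b x = 0) (hmean : ∫ x, b x = 0)
    (hT : ∀ᵐ x ∂(volume : Measure (EuclideanSpace ℝ (Fin n))),
            x ∉ tsupport b → Tb x = ∫ y, K x y * b y ∂volume) :
    ∫⁻ x in (Metric.closedBall c (2 * ρ))ᶜ, ‖Tb x‖ₑ ≤ ENNReal.ofReal A' * ∫⁻ y, ‖b y‖ₑ := by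
  have hBm : MeasurableSet (Metric.closedBall c (2 * ρ))ᶜ :=
    Metric.isClosed_closedBall.measurableSet.compl
  have hts : tsupport b ⊆ Metric.closedBall c ρ := by
    refine closure_minimal ?_ Metric.isClosed_closedBall
    intro x hx
    by_contra h
    exact hx (hsupp x h)
  have hpt : ∀ᵐ x ∂(volume : Measure (EuclideanSpace ℝ (Fin n))),
      x ∈ (Metric.closedBall c (2 * ρ))ᶜ →
        ‖Tb x‖ₑ ≤ ∫⁻ y, ‖K x y - K x c‖ₑ * ‖b y‖ₑ := by
    filter_upwards [hT] with x hx hxB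
    have hxd : 2 * ρ < ‖x - c‖ := by
      rw [← dist_eq_norm]
      simpa using hxB
    have hxt : x ∉ tsupport b := by
      intro h
      have := hts h
      rw [Metric.mem_closedBall, dist_eq_norm] at this
      linarith
    have hKx : Measurable (K x) := hK.comp measurable_prodMk_left
    have hint : Integrable (fun y => K x y * b y) volume := by
      refine Integrable.mono' (hb.norm.const_mul (A * ρ ^ (-(n : ℝ))))
        (hKx.mul hbm).aestronglyMeasurable (Eventually.of_forall fun y => ?_)
      by_cases hy : y ∈ Metric.closedBall c ρ
      · rw [Metric.mem_closedBall, dist_eq_norm] at hy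
        have h1 : ρ ≤ ‖x - y‖ := by
          have : ‖x - c‖ ≤ ‖x - y‖ + ‖y - c‖ := by
            simpa using norm_add_le (x - y) (y - c)
          linarith
        have hne : x ≠ y := by
          rintro rfl
          rw [sub_self, norm_zero] at h1
          linarith
        rw [norm_mul]
        gcongr
        refine (hsize x y hne).trans ?_
        gcongr ?_ * ?_
        exact Real.rpow_le_rpow_of_nonpos hρ h1 (by simp)
      · rw [hsupp y hy]
        simp
    have heq : Tb x = ∫ y, (K x y - K x c) * b y := by
      rw [hx hxt]
      simp_rw [sub_mul]
      rw [integral_sub hint (hb.const_mul _), integral_const_mul, hmean, mul_zero, sub_zero]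
    rw [heq]
    refine (enorm_integral_le_lintegral_enorm _).trans (le_of_eq ?_)
    simp_rw [enorm_mul]
  have hmeas : Measurable (Function.uncurry
      fun x y : EuclideanSpace ℝ (Fin n) => ‖K x y - K x c‖ₑ * ‖b y‖ₑ) := by
    have h1 : Measurable fun p : EuclideanSpace ℝ (Fin n) × EuclideanSpace ℝ (Fin n) =>
        K p.1 p.2 := hK
    have h2 : Measurable fun p : EuclideanSpace ℝ (Fin n) × EuclideanSpace ℝ (Fin n) =>
        K p.1 c := hK.comp (measurable_fst.prodMk measurable_const)
    exact (h1.sub h2).enorm.mul (hbm.comp measurable_snd).enorm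
  calc ∫⁻ x in (Metric.closedBall c (2 * ρ))ᶜ, ‖Tb x‖ₑ
      ≤ ∫⁻ x in (Metric.closedBall c (2 * ρ))ᶜ, ∫⁻ y, ‖K x y - K x c‖ₑ * ‖b y‖ₑ :=
        lintegral_mono_ae ((ae_restrict_iff' hBm).2 hpt)
    _ = ∫⁻ y, ∫⁻ x in (Metric.closedBall c (2 * ρ))ᶜ, ‖K x y - K x c‖ₑ * ‖b y‖ₑ :=
        lintegral_lintegral_swap hmeas.aemeasurable
    _ ≤ ∫⁻ y, ENNReal.ofReal A' * ‖b y‖ₑ := by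
        refine lintegral_mono fun y => ?_
        by_cases hy : y ∈ Metric.closedBall c ρ
        · have hKd : Measurable fun x => ‖K x y - K x c‖ₑ := by
            have h1 : Measurable fun x => K x y := hK.comp measurable_prodMk_right
            have h2 : Measurable fun x => K x c := hK.comp measurable_prodMk_right
            exact (h1.sub h2).enorm
          rw [lintegral_mul_const _ hKd]
          gcongr
          refine le_trans ?_ (hhor c y)
          refine le_trans (lintegral_mono_set (t := {x | 2 * ‖c - y‖ ≤ ‖x - c‖}) ?_)
            (le_of_eq ?_)
          · intro x hx
            rw [Metric.mem_closedBall, dist_comm, dist_eq_norm] at hy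
            have hxd : 2 * ρ < ‖x - c‖ := by
              rw [← dist_eq_norm]
              simpa using hx
            show 2 * ‖c - y‖ ≤ ‖x - c‖
            linarith
          · refine lintegral_congr fun x => ?_
            exact enorm_sub_rev _ _
        · rw [hsupp y hy]
          simp
    _ = _ := lintegral_const_mul _ hbm.enorm

/-- If `f` vanishes a.e. its Lorentz norm is zero. -/
lemma lorentz_eq_zero {μ : Measure α} {f : α → ℂ} {r : ℝ} (hr : 1 < r) (hf : f =ᵐ[μ] 0) :
    lorentzNorm μ (ENNReal.ofReal r) 1 f = 0 := by
  rw [lorentz_one_eq hr]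
  have : ∀ t, rearr μ f t = 0 := by
    intro t
    refine le_antisymm (rearr_le (le_trans (le_of_eq ?_) (zero_le (a := t)))) (zero_le (a := _))
    refine measure_mono_null (fun x hx => ?_) (ae_iff.1 hf)
    intro h
    have hx : 0 < ‖f x‖ₑ := hx
    rw [h] at hx
    simp at hx
  simp [this]

/-- The constant for the good part. -/
def goodC (n : ℕ) (r : ℝ) : ℝ := (3 * (r + r / (r - 1))) ^ r * (2 ^ n) ^ (r - 1)

lemma good_arith {n : ℕ} {r b l G : ℝ} (hr : 1 < r) (hb : 0 < b) (hl : 0 < l) (hG : 0 < G) :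
    (b * ((r + r / (r - 1)) * (2 ^ n * (l / b) * (G / (2 ^ n * (l / b))) ^ (1 / r))) / (l / 3)) ^ r
      = goodC n r * (b * G / l) := by
  have hr1 : 0 < r - 1 := by linarith
  have hr0 : 0 < r := by linarith
  set D := r + r / (r - 1) with hD
  have hDp : 0 < D := by positivity
  have e1 : b * (D * (2 ^ n * (l / b) * (G / (2 ^ n * (l / b))) ^ (1 / r))) / (l / 3)
      = (3 * D) * (2 ^ n) * (G / (2 ^ n * (l / b))) ^ (1 / r) := by
    field_simp
  rw [e1, Real.mul_rpow (by positivity) (by positivity), Real.mul_rpow (by positivity)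
    (by positivity), ← Real.rpow_mul (by positivity), one_div, inv_mul_cancel₀ hr0.ne',
    Real.rpow_one, goodC, ← hD, Real.rpow_sub_one (by positivity)]
  field_simp

/-! ### The a priori estimate -/

lemma apriori {n : ℕ} (hn : 0 < n) {r : ℝ} (hr : 1 < r)
    {K : EuclideanSpace ℝ (Fin n) → EuclideanSpace ℝ (Fin n) → ℂ}
    (hK : Measurable (Function.uncurry K))
    {T : (EuclideanSpace ℝ (Fin n) → ℂ) → (EuclideanSpace ℝ (Fin n) → ℂ)}
    {A A' : ℝ} {B : ℝ≥0∞} (hA : 0 ≤ A) (hB0 : 0 < B) (hBt : B < ∞)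
    (hTm : ∀ f, Measurable f → Measurable (T f))
    (hadd : ∀ f g, Measurable f → Measurable g →
          lorentzNorm volume (ENNReal.ofReal r) 1 f < ∞ →
          lorentzNorm volume (ENNReal.ofReal r) 1 g < ∞ →
          T (f + g) =ᵐ[volume] T f + T g)
    (hsmul : ∀ (c : ℂ) f, Measurable f →
          lorentzNorm volume (ENNReal.ofReal r) 1 f < ∞ →
          T (c • f) =ᵐ[volume] c • T f)
    (hbd : ∀ f, Measurable f →
          lorentzNorm volume (ENNReal.ofReal r) ∞ (T f)
            ≤ B * lorentzNorm volume (ENNReal.ofReal r) 1 f)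
    (hsize : ∀ x y, x ≠ y → ‖K x y‖ ≤ A * ‖x - y‖ ^ (-(n : ℝ)))
    (hassoc : ∀ f, Measurable f → HasCompactSupport f →
          lorentzNorm volume (ENNReal.ofReal r) 1 f < ∞ →
          ∀ᵐ x ∂(volume : Measure (EuclideanSpace ℝ (Fin n))),
            x ∉ tsupport f → T f x = ∫ y, K x y * f y ∂volume)
    (hhor : ∀ y y', ∫⁻ x in {x | 2 * ‖y - y'‖ ≤ ‖x - y‖},
          (‖K x y - K x y'‖₊ : ℝ≥0∞) ∂volume ≤ ENNReal.ofReal A')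
    {f : EuclideanSpace ℝ (Fin n) → ℂ} (hfm : Measurable f) (hf : Integrable f volume)
    (hfL : lorentzNorm volume (ENNReal.ofReal r) 1 f < ∞) {l : ℝ} (hl : 0 < l) :
    ENNReal.ofReal l * volume {x | ENNReal.ofReal l < ‖T f x‖ₑ} ≤
      (ENNReal.ofReal (goodC n r) + geomC n + 6) * (ENNReal.ofReal A' + B) * ∫⁻ x, ‖f x‖ₑ := by
  have hl3 : 0 < l / 3 := by positivity
  have hl0 : ENNReal.ofReal l ≠ 0 := (ENNReal.ofReal_pos.2 hl).ne'
  have hl30 : ENNReal.ofReal (l / 3) ≠ 0 := (ENNReal.ofReal_pos.2 hl3).ne'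
  have hIt : ∫⁻ x, ‖f x‖ₑ ≠ ∞ := hf.2.ne
  -- trivial case
  by_cases hG0 : ∫⁻ x, ‖f x‖ₑ = 0
  · have hf0 : f =ᵐ[volume] 0 := by
      rw [lintegral_eq_zero_iff hfm.enorm] at hG0
      filter_upwards [hG0] with x hx
      simpa using hx
    have h1 := hbd f hfm
    rw [lorentz_eq_zero hr hf0, mul_zero] at h1
    have h2 := distr_of_weak (μ := volume) (F := T f) hr hl0 ENNReal.ofReal_ne_top
    rw [le_zero_iff.1 h1, ENNReal.zero_div, ENNReal.zero_rpow_of_pos (by linarith)] at h2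
    rw [le_zero_iff.1 h2]
    simp
  set G : ℝ := (∫⁻ x, ‖f x‖ₑ).toReal with hGdef
  have hGe : ∫⁻ x, ‖f x‖ₑ = ENNReal.ofReal G := (ENNReal.ofReal_toReal hIt).symm
  have hG : 0 < G := ENNReal.toReal_pos hG0 hIt
  set b : ℝ := B.toReal with hbdef
  have hBe : B = ENNReal.ofReal b := (ENNReal.ofReal_toReal hBt.ne).symm
  have hb : 0 < b := ENNReal.toReal_pos hB0.ne' hBt.ne
  have hlb : 0 < l / b := by positivity
  obtain ⟨ι, hcount, Q, c, ρ, g, hQm, hQd, hρ, hQB, hQvol, hQsum, hgm, hgM, hfg, hfg0, hgI,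
    hmean, hbsum⟩ := cz_decomp hn hfm hf hlb
  have hM : 0 < 2 ^ n * (l / b) := by positivity
  -- the measure of the union of the cubes
  have hQsum' : ∑' j, volume (Q j) ≤ ENNReal.ofReal (b * G / l) := by
    refine hQsum.trans (le_of_eq ?_)
    rw [hGe, ← ENNReal.ofReal_div_of_pos hlb]
    congr 1
    field_simp
  have hQst : ∑' j, volume (Q j) ≠ ∞ := (hQsum'.trans_lt ENNReal.ofReal_lt_top).ne
  -- the good part
  have hgL : lorentzNorm volume (ENNReal.ofReal r) 1 g ≤ ENNReal.ofReal
      ((r + r / (r - 1)) * (2 ^ n * (l / b) * (G / (2 ^ n * (l / b))) ^ (1 / r))) :=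
    lorentz_good hgm.aemeasurable hr hM hG hgM (hgI.trans hGe.le)
  have hgfin : lorentzNorm volume (ENNReal.ofReal r) 1 g < ∞ := hgL.trans_lt ENNReal.ofReal_lt_top
  have hr1 : 0 < r - 1 := by linarith
  have hgood : volume {x | ENNReal.ofReal (l / 3) < ‖T g x‖ₑ} ≤
      ENNReal.ofReal (goodC n r * (b * G / l)) := by
    refine (distr_of_weak hr hl30 ENNReal.ofReal_ne_top).trans ?_
    rw [← good_arith hr hb hl hG, ← ENNReal.ofReal_rpow_of_nonneg (by positivity) (by linarith),
      ENNReal.ofReal_div_of_pos hl3, ENNReal.ofReal_mul hb.le, ← hBe]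
    refine ENNReal.rpow_le_rpow ?_ (by linarith)
    gcongr
    exact (hbd g hgm).trans (by gcongr)
  -- pieces of the bad part
  set h : EuclideanSpace ℝ (Fin n) → ℂ := fun x => f x - g x with hh
  have hhm : Measurable h := hfm.sub hgm
  have hpiece : ∀ E : Set (EuclideanSpace ℝ (Fin n)), ∀ m : ℝ, volume E ≤ ENNReal.ofReal m →
      lorentzNorm volume (ENNReal.ofReal r) 1 (E.indicator h) ≤
        ∫⁻ t in Ioc 0 m, maj volume r f (ENNReal.ofReal (2 ^ n * (l / b))) t := by
    intro E m hEm
    refine lorentz_le_maj hr (fun x => ?_) (fun x hx => indicator_of_notMem hx _) hEm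
    by_cases hx : x ∈ E
    · rw [indicator_of_mem hx]
      exact hfg x
    · rw [indicator_of_notMem hx]
      simp
  have hpfin : ∀ E : Set (EuclideanSpace ℝ (Fin n)), volume E ≠ ∞ →
      lorentzNorm volume (ENNReal.ofReal r) 1 (E.indicator h) < ∞ := by
    intro E hE
    refine (hpiece E (volume E).toReal (ENNReal.ofReal_toReal hE).ge).trans_lt ?_
    exact (maj_finite hr ENNReal.ofReal_ne_top hfL ENNReal.toReal_nonneg).lt_top
  have hQt : ∀ j, volume (Q j) ≠ ∞ := fun j =>
    ((ENNReal.le_tsum j).trans_lt hQst.lt_top).ne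
  have hbigt : ∀ s : Finset ι, volume (⋃ j ∈ s, Q j) ≠ ∞ := fun s =>
    ((measure_biUnion_finset_le s Q).trans_lt (ENNReal.sum_lt_top.2 fun j _ => (hQt j).lt_top)).ne
  have hsm : ∀ s : Finset ι, MeasurableSet (⋃ j ∈ s, Q j) := fun s =>
    Finset.measurableSet_biUnion s fun j _ => hQm j
  -- finite linearity
  have hlin : ∀ s : Finset ι, T ((⋃ j ∈ s, Q j).indicator h) =ᵐ[volume]
      fun x => ∑ j ∈ s, T ((Q j).indicator h) x := by
    classical
    intro s
    induction s using Finset.induction_on with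
    | empty =>
      have h0 : lorentzNorm volume (ENNReal.ofReal r) 1
          (0 : EuclideanSpace ℝ (Fin n) → ℂ) < ∞ := by
        rw [lorentz_eq_zero hr (ae_eq_refl _)]
        exact ENNReal.zero_lt_top
      have := hsmul 0 0 measurable_zero h0
      simp only [zero_smul] at this
      simp only [Finset.notMem_empty, iUnion_of_empty, iUnion_empty, indicator_empty,
        Finset.sum_empty]
      exact this
    | insert j s hjs ih =>
      have hd : Disjoint (Q j) (⋃ i ∈ s, Q i) := by
        rw [Set.disjoint_iUnion₂_right]
        intro i hi
        exact hQd (fun e => hjs (e ▸ hi))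
      have e1 : (⋃ i ∈ insert j s, Q i).indicator h =
          (Q j).indicator h + (⋃ i ∈ s, Q i).indicator h := by
        rw [Finset.set_biUnion_insert, indicator_union_of_disjoint hd]
        rfl
      rw [e1]
      filter_upwards [ih, hadd _ _ (hhm.indicator (hQm j)) (hhm.indicator (hsm s))
        (hpfin _ (hQt j)) (hpfin _ (hbigt s))] with x hx1 hx2
      rw [hx2, Pi.add_apply, hx1, Finset.sum_insert hjs]
  -- each bad piece
  have hbad : ∀ j, ∫⁻ x in (Metric.closedBall (c j) (2 * ρ j))ᶜ, ‖T ((Q j).indicator h) x‖ₑ ≤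
      ENNReal.ofReal A' * ∫⁻ x in Q j, ‖f x - g x‖ₑ := by
    intro j
    have hzero : ∀ x, x ∉ Metric.closedBall (c j) (ρ j) → (Q j).indicator h x = 0 :=
      fun x hx => indicator_of_notMem (fun hxQ => hx (hQB j hxQ)) _
    have hbint : Integrable ((Q j).indicator h) volume := by
      refine ⟨(hhm.indicator (hQm j)).aestronglyMeasurable, ?_⟩
      rw [hasFiniteIntegral_iff_enorm]
      simp_rw [enorm_indicator_eq_indicator_enorm]
      rw [lintegral_indicator (hQm j)]
      calc _ ≤ ∑' j, ∫⁻ x in Q j, ‖f x - g x‖ₑ :=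
            ENNReal.le_tsum (f := fun j => ∫⁻ x in Q j, ‖f x - g x‖ₑ) j
        _ ≤ _ := hbsum
        _ < ∞ := ENNReal.mul_lt_top (by norm_num) hIt.lt_top
    have hcs : HasCompactSupport ((Q j).indicator h) :=
      HasCompactSupport.intro (isCompact_closedBall (c j) (ρ j)) hzero
    have := bad_piece hK hA hsize hhor (hhm.indicator (hQm j)) hbint (hρ j) hzero
      (by rw [integral_indicator (hQm j)]; exact hmean j)
      (hassoc _ (hhm.indicator (hQm j)) hcs (hpfin _ (hQt j)))
    refine this.trans (le_of_eq ?_)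
    congr 1
    simp_rw [enorm_indicator_eq_indicator_enorm]
    rw [lintegral_indicator (hQm j)]
  -- exceptional set
  set Ω : Set (EuclideanSpace ℝ (Fin n)) := ⋃ j, Metric.closedBall (c j) (2 * ρ j) with hΩ
  have hΩm : MeasurableSet Ω :=
    MeasurableSet.iUnion fun j => Metric.isClosed_closedBall.measurableSet
  have hΩv : volume Ω ≤ geomC n * ENNReal.ofReal (b * G / l) := by
    refine (measure_iUnion_le _).trans ?_
    simp_rw [hQvol]
    rw [ENNReal.tsum_mul_left]
    gcongr
  have hbadsum : ∀ s : Finset ι, volume {x | x ∉ Ω ∧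
      ENNReal.ofReal (l / 3) < ‖∑ j ∈ s, T ((Q j).indicator h) x‖ₑ} ≤
      ENNReal.ofReal A' * (2 * ENNReal.ofReal G) / ENNReal.ofReal (l / 3) := by
    intro s
    have hTj : ∀ j, Measurable fun x => ‖T ((Q j).indicator h) x‖ₑ := fun j =>
      (hTm _ (hhm.indicator (hQm j))).enorm
    have hFm : Measurable fun x => ∑ j ∈ s, ‖T ((Q j).indicator h) x‖ₑ :=
      Finset.measurable_fun_sum s fun j _ => hTj j
    calc _ ≤ (volume.restrict Ωᶜ)
          {x | ENNReal.ofReal (l / 3) ≤ ∑ j ∈ s, ‖T ((Q j).indicator h) x‖ₑ} := by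
          rw [Measure.restrict_apply (measurableSet_le measurable_const hFm)]
          refine measure_mono ?_
          rintro x ⟨hx1, hx2⟩
          exact ⟨hx2.le.trans (enorm_sum_le _ _), hx1⟩
      _ ≤ (∫⁻ x in Ωᶜ, ∑ j ∈ s, ‖T ((Q j).indicator h) x‖ₑ) / ENNReal.ofReal (l / 3) :=
          meas_ge_le_lintegral_div hFm.aemeasurable hl30 ENNReal.ofReal_ne_top
      _ ≤ _ := by
          gcongr
          rw [lintegral_finsetSum s fun j _ => hTj j]
          calc _ ≤ ∑ j ∈ s, ENNReal.ofReal A' * ∫⁻ x in Q j, ‖f x - g x‖ₑ := by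
                refine Finset.sum_le_sum fun j _ => le_trans (lintegral_mono_set ?_) (hbad j)
                exact compl_subset_compl.2 (subset_iUnion
                  (fun j => Metric.closedBall (c j) (2 * ρ j)) j)
            _ ≤ ∑' j, ENNReal.ofReal A' * ∫⁻ x in Q j, ‖f x - g x‖ₑ := ENNReal.sum_le_tsum s
            _ = ENNReal.ofReal A' * ∑' j, ∫⁻ x in Q j, ‖f x - g x‖ₑ := ENNReal.tsum_mul_left
            _ ≤ _ := by
              rw [← hGe]
              gcongr
  -- the tail
  set m : Finset ι → ℝ := fun s => (∑' j : {j // j ∉ s}, volume (Q j)).toReal with hm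
  set R : Finset ι → Set (EuclideanSpace ℝ (Fin n)) := fun s => ⋃ j : {j // j ∉ s}, Q j with hR
  have hRm : ∀ s, MeasurableSet (R s) := fun s => MeasurableSet.iUnion fun j => hQm j
  have htailt : ∀ s : Finset ι, ∑' j : {j // j ∉ s}, volume (Q j) ≤ ∑' j, volume (Q j) := fun s =>
    ENNReal.tsum_comp_le_tsum_of_injective Subtype.val_injective _
  have hRv : ∀ s, volume (R s) ≤ ENNReal.ofReal (m s) := by
    intro s
    rw [hm, ENNReal.ofReal_toReal (((htailt s).trans_lt hQst.lt_top).ne)]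
    exact measure_iUnion_le _
  have hRfin : ∀ s, volume (R s) ≠ ∞ := fun s => ((hRv s).trans_lt ENNReal.ofReal_lt_top).ne
  set m0 : ℝ := (∑' j, volume (Q j)).toReal with hm0
  have hmm0 : ∀ s, m s ≤ m0 := fun s => ENNReal.toReal_mono hQst (htailt s)
  set Φ : Finset ι → ℝ≥0∞ := fun s =>
    ∫⁻ t in Ioc 0 (m s), maj volume r f (ENNReal.ofReal (2 ^ n * (l / b))) t with hΦ
  have hm_tend : Tendsto (fun s => ENNReal.ofReal (m s)) atTop (𝓝 0) := by
    refine (ENNReal.tendsto_tsum_compl_atTop_zero hQst).congr fun s => ?_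
    rw [hm, ENNReal.ofReal_toReal (((htailt s).trans_lt hQst.lt_top).ne)]
  have hΦ0 : Tendsto Φ atTop (𝓝 0) := by
    have h1 := tendsto_setLIntegral_zero (μ := volume.restrict (Ioc 0 m0))
      (maj_finite (μ := (volume : Measure (EuclideanSpace ℝ (Fin n)))) hr
        (ENNReal.ofReal_ne_top (r := 2 ^ n * (l / b))) hfL ENNReal.toReal_nonneg)
      (l := atTop) (s := fun s : Finset ι => Ioc 0 (m s)) (by
        refine tendsto_of_tendsto_of_tendsto_of_le_of_le tendsto_const_nhds hm_tend
          (fun s => zero_le (a := _)) (fun s => ?_)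
        refine (Measure.restrict_apply_le _ _).trans (le_of_eq ?_)
        rw [Real.volume_Ioc, sub_zero])
    refine h1.congr fun s => ?_
    rw [Measure.restrict_restrict measurableSet_Ioc,
      inter_eq_self_of_subset_left (Ioc_subset_Ioc_right (hmm0 s))]
  have htail : ∀ s, volume {x | ENNReal.ofReal (l / 3) < ‖T ((R s).indicator h) x‖ₑ} ≤
      (B * Φ s / ENNReal.ofReal (l / 3)) ^ r := by
    intro s
    refine (distr_of_weak hr hl30 ENNReal.ofReal_ne_top).trans
      (ENNReal.rpow_le_rpow ?_ (by linarith))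
    gcongr
    refine (hbd _ (hhm.indicator (hRm s))).trans ?_
    gcongr
    exact hpiece _ _ (hRv s)
  have htail0 : Tendsto (fun s => (B * Φ s / ENNReal.ofReal (l / 3)) ^ r) atTop (𝓝 0) := by
    have h1 : Tendsto (fun s => B * Φ s / ENNReal.ofReal (l / 3)) atTop (𝓝 0) := by
      have := ENNReal.Tendsto.div_const (ENNReal.Tendsto.const_mul hΦ0 (Or.inr hBt.ne))
        (b := ENNReal.ofReal (l / 3)) (Or.inr hl30)
      simpa using this
    have h2 := (ENNReal.continuous_rpow_const (y := r)).tendsto 0 |>.comp h1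
    rw [ENNReal.zero_rpow_of_pos (by linarith)] at h2
    exact h2
  -- splitting
  have hsplit : ∀ s : Finset ι, T f =ᵐ[volume] fun x =>
      T g x + (∑ j ∈ s, T ((Q j).indicator h) x + T ((R s).indicator h) x) := by
    intro s
    have hd : Disjoint (⋃ j ∈ s, Q j) (R s) := by
      rw [Set.disjoint_iUnion₂_left]
      intro i hi
      rw [Set.disjoint_iUnion_right]
      intro j
      exact hQd (fun e => j.2 (e ▸ hi))
    have hun : (⋃ j ∈ s, Q j) ∪ R s = ⋃ j, Q j := by
      ext x
      simp only [hR, mem_union, mem_iUnion]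
      constructor
      · rintro (⟨j, _, hx⟩ | ⟨j, hx⟩)
        · exact ⟨j, hx⟩
        · exact ⟨j, hx⟩
      · rintro ⟨j, hx⟩
        by_cases hj : j ∈ s
        · exact Or.inl ⟨j, hj, hx⟩
        · exact Or.inr ⟨⟨j, hj⟩, hx⟩
    have hUfin : volume (⋃ j, Q j) ≠ ∞ := ((measure_iUnion_le _).trans_lt hQst.lt_top).ne
    have e1 : f = g + (⋃ j, Q j).indicator h := by
      funext x
      rw [Pi.add_apply]
      by_cases hx : x ∈ ⋃ j, Q j
      · rw [indicator_of_mem hx, hh]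
        ring
      · rw [indicator_of_notMem hx, add_zero]
        exact sub_eq_zero.1 (hfg0 x hx)
    have e2 : (⋃ j, Q j).indicator h = (⋃ j ∈ s, Q j).indicator h + (R s).indicator h := by
      rw [← hun, indicator_union_of_disjoint hd]
      rfl
    have a1 := hadd g ((⋃ j, Q j).indicator h) hgm (hhm.indicator (MeasurableSet.iUnion hQm))
      hgfin (hpfin _ hUfin)
    rw [← e1] at a1
    have a2 := hadd _ _ (hhm.indicator (hsm s)) (hhm.indicator (hRm s)) (hpfin _ (hbigt s))
      (hpfin _ (hRfin s))
    rw [← e2] at a2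
    filter_upwards [a1, a2, hlin s] with x h1 h2 h3
    rw [h1, Pi.add_apply, h2, Pi.add_apply, h3]
  have hl333 : ENNReal.ofReal l =
      ENNReal.ofReal (l / 3) + (ENNReal.ofReal (l / 3) + ENNReal.ofReal (l / 3)) := by
    rw [← ENNReal.ofReal_add hl3.le hl3.le, ← ENNReal.ofReal_add hl3.le (by positivity)]
    congr 1
    ring
  have hfinal : volume {x | ENNReal.ofReal l < ‖T f x‖ₑ} ≤
      ENNReal.ofReal (goodC n r * (b * G / l)) + geomC n * ENNReal.ofReal (b * G / l) +
        ENNReal.ofReal A' * (2 * ENNReal.ofReal G) / ENNReal.ofReal (l / 3) := by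
    set X := ENNReal.ofReal (goodC n r * (b * G / l)) + geomC n * ENNReal.ofReal (b * G / l) +
        ENNReal.ofReal A' * (2 * ENNReal.ofReal G) / ENNReal.ofReal (l / 3) with hX
    have hs : ∀ s : Finset ι, volume {x | ENNReal.ofReal l < ‖T f x‖ₑ} ≤
        X + (B * Φ s / ENNReal.ofReal (l / 3)) ^ r := by
      intro s
      refine le_trans (measure_mono_ae (t := ({x | ENNReal.ofReal (l / 3) < ‖T g x‖ₑ} ∪ Ω ∪
        {x | x ∉ Ω ∧ ENNReal.ofReal (l / 3) < ‖∑ j ∈ s, T ((Q j).indicator h) x‖ₑ}) ∪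
        {x | ENNReal.ofReal (l / 3) < ‖T ((R s).indicator h) x‖ₑ}) ?_) ?_
      · filter_upwards [hsplit s] with x hx hxl
        have hxl : ENNReal.ofReal l < ‖T f x‖ₑ := hxl
        by_contra hcon
        have hcon : x ∉ ({x | ENNReal.ofReal (l / 3) < ‖T g x‖ₑ} ∪ Ω ∪
          {x | x ∉ Ω ∧ ENNReal.ofReal (l / 3) < ‖∑ j ∈ s, T ((Q j).indicator h) x‖ₑ}) ∪
          {x | ENNReal.ofReal (l / 3) < ‖T ((R s).indicator h) x‖ₑ} := hcon
        simp only [mem_union, Set.mem_ofPred_eq, not_or, not_and, not_lt] at hcon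
        obtain ⟨⟨⟨c1, c2⟩, c3⟩, c4⟩ := hcon
        have c3 := c3 c2
        rw [hx, hl333] at hxl
        refine absurd hxl (not_lt.2 ?_)
        refine (enorm_add_le _ _).trans (add_le_add c1 ?_)
        exact (enorm_add_le _ _).trans (add_le_add c3 c4)
      · refine (measure_union_le _ _).trans (add_le_add ?_ (htail s))
        refine (measure_union_le _ _).trans (add_le_add ?_ (hbadsum s))
        exact (measure_union_le _ _).trans (add_le_add hgood hΩv)
    have ht : Tendsto (fun s => X + (B * Φ s / ENNReal.ofReal (l / 3)) ^ r) atTop (𝓝 (X + 0)) :=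
      tendsto_const_nhds.add htail0
    rw [add_zero] at ht
    exact ge_of_tendsto ht (Eventually.of_forall hs)
  have hgC : 0 ≤ goodC n r := by unfold goodC; positivity
  have hlt : ENNReal.ofReal l ≠ ∞ := ENNReal.ofReal_ne_top
  have q1 : ENNReal.ofReal l * ENNReal.ofReal (b * G / l) = B * ENNReal.ofReal G := by
    rw [hBe, ← ENNReal.ofReal_mul hl.le, ← ENNReal.ofReal_mul hb.le]
    congr 1
    field_simp
  have q2 : ENNReal.ofReal l / ENNReal.ofReal (l / 3) = 3 := by
    rw [← ENNReal.ofReal_div_of_pos hl3, show l / (l / 3) = 3 by field_simp]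
    simp
  calc ENNReal.ofReal l * volume {x | ENNReal.ofReal l < ‖T f x‖ₑ}
      ≤ ENNReal.ofReal l * (ENNReal.ofReal (goodC n r * (b * G / l)) +
        geomC n * ENNReal.ofReal (b * G / l) +
        ENNReal.ofReal A' * (2 * ENNReal.ofReal G) / ENNReal.ofReal (l / 3)) := by gcongr
    _ = ENNReal.ofReal (goodC n r) * (ENNReal.ofReal l * ENNReal.ofReal (b * G / l)) +
        geomC n * (ENNReal.ofReal l * ENNReal.ofReal (b * G / l)) +
        (ENNReal.ofReal l / ENNReal.ofReal (l / 3)) *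
          (ENNReal.ofReal A' * (2 * ENNReal.ofReal G)) := by
        rw [ENNReal.ofReal_mul hgC]
        simp only [div_eq_mul_inv]
        ring
    _ = (ENNReal.ofReal (goodC n r) + geomC n) * (B * ENNReal.ofReal G) +
          6 * (ENNReal.ofReal A' * ENNReal.ofReal G) := by
        rw [q1, q2]
        ring
    _ ≤ (ENNReal.ofReal (goodC n r) + geomC n) * (B * ENNReal.ofReal G) +
          6 * (ENNReal.ofReal A' * ENNReal.ofReal G) +
          ((ENNReal.ofReal (goodC n r) + geomC n) * (ENNReal.ofReal A' * ENNReal.ofReal G) +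
          6 * (B * ENNReal.ofReal G)) := le_self_add
    _ = _ := by
        rw [hGe]
        ring

/-- The Calderón–Zygmund theorem assuming only `L^{r,1} → L^{r,∞}` boundedness:
a singular integral operator with kernel satisfying the size and Hörmander conditions
which is bounded from `L^{r,1}(ℝⁿ)` to `L^{r,∞}(ℝⁿ)` admits an extension of
weak-type `(1,1)`, with constant proportional to `A' + ‖T‖_{L^{r,1}→L^{r,∞}}`. -/
theorem stmt16 (n : ℕ) (hn : 0 < n) (r : ℝ) (hr : 1 < r) :
    ∃ C : ℝ≥0∞, 0 < C ∧ C < ∞ ∧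
      ∀ (K : EuclideanSpace ℝ (Fin n) → EuclideanSpace ℝ (Fin n) → ℂ),
        Measurable (Function.uncurry K) →
      ∀ (T : (EuclideanSpace ℝ (Fin n) → ℂ) → (EuclideanSpace ℝ (Fin n) → ℂ))
        (A A' : ℝ) (B : ℝ≥0∞), 0 ≤ A → 0 ≤ A' → 0 < B → B < ∞ →
        -- T has measurable values
        (∀ f, Measurable f → Measurable (T f)) →
        -- T is linear on L^{r,1}
        (∀ f g, Measurable f → Measurable g →
          lorentzNorm volume (ENNReal.ofReal r) 1 f < ∞ →
          lorentzNorm volume (ENNReal.ofReal r) 1 g < ∞ →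
          T (f + g) =ᵐ[volume] T f + T g) →
        (∀ (c : ℂ) f, Measurable f →
          lorentzNorm volume (ENNReal.ofReal r) 1 f < ∞ →
          T (c • f) =ᵐ[volume] c • T f) →
        -- (iii) T is bounded from L^{r,1} to L^{r,∞} with norm at most B
        (∀ f, Measurable f →
          lorentzNorm volume (ENNReal.ofReal r) ∞ (T f)
            ≤ B * lorentzNorm volume (ENNReal.ofReal r) 1 f) →
        -- (i) kernel size condition
        (∀ x y, x ≠ y → ‖K x y‖ ≤ A * ‖x - y‖ ^ (-(n : ℝ))) →
        -- T is associated with the kernel K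
        (∀ f, Measurable f → HasCompactSupport f →
          lorentzNorm volume (ENNReal.ofReal r) 1 f < ∞ →
          ∀ᵐ x ∂(volume : Measure (EuclideanSpace ℝ (Fin n))),
            x ∉ tsupport f → T f x = ∫ y, K x y * f y ∂volume) →
        -- (ii) Hörmander condition
        (∀ y y', ∫⁻ x in {x | 2 * ‖y - y'‖ ≤ ‖x - y‖},
          (‖K x y - K x y'‖₊ : ℝ≥0∞) ∂volume ≤ ENNReal.ofReal A') →
        -- conclusion: T admits a weak-type (1,1) extension
        ∃ Text : (EuclideanSpace ℝ (Fin n) → ℂ) → (EuclideanSpace ℝ (Fin n) → ℂ),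
          (∀ f, Measurable f → Integrable f volume →
            lorentzNorm volume (ENNReal.ofReal r) 1 f < ∞ →
            Text f =ᵐ[volume] T f) ∧
          (∀ f, Measurable f → Integrable f volume →
            lorentzNorm volume 1 ∞ (Text f)
              ≤ C * (ENNReal.ofReal A' + B) * eLpNorm f 1 volume) := by
  refine ⟨ENNReal.ofReal (goodC n r) + geomC n + 6, ?_, ?_, ?_⟩
  · exact lt_of_lt_of_le (by norm_num) (le_add_self (a := (6 : ℝ≥0∞)))
  · exact ENNReal.add_lt_top.2 ⟨ENNReal.add_lt_top.2
      ⟨ENNReal.ofReal_lt_top, (geomC_ne_top n).lt_top⟩, by norm_num⟩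
  intro K hK T A A' B hA _ hB0 hBt hTm hadd hsmul hbd hsize hassoc hhor
  classical
  refine ⟨fun f => if lorentzNorm volume (ENNReal.ofReal r) 1 f < ∞ then T f else 0, ?_, ?_⟩
  · intro f _ _ hfL
    simp only [if_pos hfL]
    exact ae_eq_refl _
  · intro f hfm hf
    refine weak_of_distr fun l hl => ?_
    rw [eLpNorm_one_eq_lintegral_enorm]
    by_cases hfL : lorentzNorm volume (ENNReal.ofReal r) 1 f < ∞
    · simp only [if_pos hfL]
      exact apriori hn hr hK hA hB0 hBt hTm hadd hsmul hbd hsize hassoc hhor hfm hf hfL hl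
    · simp [if_neg hfL]

end Paper
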